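/- arXiv:2106.15891 — 8 statements merged into one kernel-verified Lean document; each statement's English description precedes it below -/
import Mathlib

section
/- For every α₀ ∈ (0, π) such that e(α₀) > 0 and all six arccos arguments appearing in the definitions of β, γ, δ lie in the open interval (−1, 1), the function β is differentiable at α₀ with derivative β'(α₀) = −d·sin δ(α₀)/(b·sin γ(α₀)). -/
open Real Set

/-- The sine of the angle between sides `p` and `q` of a triangle with twice the area equal
to `K`. -/
lemma sqrt_one_sub_cosine_rule_sq {p q r K : ℝ} (hp : 0 < p) (hq : 0 < q) (hK : 0 ≤ K)
    (h : 4 * K ^ 2 = 4 * p ^ 2 * q ^ 2 - (p ^ 2 + q ^ 2 - r ^ 2) ^ 2) :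
    √(1 - ((p ^ 2 + q ^ 2 - r ^ 2) / (2 * p * q)) ^ 2) = K / (p * q) := by
  have h' : 1 - ((p ^ 2 + q ^ 2 - r ^ 2) / (2 * p * q)) ^ 2 = (K / (p * q)) ^ 2 := by
    field_simp
    linarith
  rw [h', Real.sqrt_sq (by positivity)]

/-- The derivative of the angle between sides `p` and `f x` of a triangle with third side `q`
and with twice the area equal to `K` at `x`. -/
lemma hasDerivAt_arccos_cosine_rule {f : ℝ → ℝ} {p q K f' x : ℝ} (hf : HasDerivAt f f' x)
    (hp : 0 < p) (hfx : 0 < f x) (hK : 0 < K)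
    (h : 4 * K ^ 2 = 4 * p ^ 2 * f x ^ 2 - (p ^ 2 + f x ^ 2 - q ^ 2) ^ 2) :
    HasDerivAt (fun t ↦ Real.arccos ((p ^ 2 + f t ^ 2 - q ^ 2) / (2 * p * f t)))
      (-((q ^ 2 + f x ^ 2 - p ^ 2) / (2 * f x * K)) * f') x := by
  have hs := sqrt_one_sub_cosine_rule_sq hp hfx hK.le h
  have hpos : 0 < √(1 - ((p ^ 2 + f x ^ 2 - q ^ 2) / (2 * p * f x)) ^ 2) := by
    rw [hs]
    positivity
  have hlt := Real.sqrt_pos.mp hpos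
  have hq : HasDerivAt (fun t ↦ (p ^ 2 + f t ^ 2 - q ^ 2) / (2 * p * f t)) _ x :=
    (((hf.pow 2).const_add (p ^ 2)).sub_const (q ^ 2)).div (hf.const_mul (2 * p)) (by positivity)
  have hacos := Real.hasDerivAt_arccos (x := (p ^ 2 + f x ^ 2 - q ^ 2) / (2 * p * f x))
    (by intro h1; rw [h1] at hlt; norm_num at hlt)
    (by intro h1; rw [h1] at hlt; norm_num at hlt)
  refine (hacos.comp x hq).congr_deriv ?_
  rw [hs]
  simp only [Pi.pow_apply]
  field_simp
  push_cast
  ring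

/-- Fix positive reals `a, b, c, d`. For `α ∈ (0, π)` set `e(α) = √(a² + d² − 2ad cos α)` and
define the interior angles
`β(α) = arccos((a² + e² − d²)/(2ae)) + arccos((b² + e² − c²)/(2be))`,
`γ(α) = arccos((b² + c² − e²)/(2bc))`,
`δ(α) = arccos((d² + e² − a²)/(2de)) + arccos((c² + e² − b²)/(2ce))`.
For every `α₀ ∈ (0, π)` such that `e(α₀) > 0` and all the arccos arguments appearing in the
definitions of `β, γ, δ` lie in `(−1, 1)`, the function `β` is differentiable at `α₀` with
derivative `β'(α₀) = −d sin δ(α₀)/(b sin γ(α₀))`. -/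
theorem beta_hasDerivAt (a b c d : ℝ) (ha : 0 < a) (hb : 0 < b) (hc : 0 < c) (hd : 0 < d)
    (e β γ δ : ℝ → ℝ)
    (he : ∀ α, e α = Real.sqrt (a ^ 2 + d ^ 2 - 2 * a * d * Real.cos α))
    (hβ : ∀ α, β α = Real.arccos ((a ^ 2 + (e α) ^ 2 - d ^ 2) / (2 * a * e α))
      + Real.arccos ((b ^ 2 + (e α) ^ 2 - c ^ 2) / (2 * b * e α)))
    (hγ : ∀ α, γ α = Real.arccos ((b ^ 2 + c ^ 2 - (e α) ^ 2) / (2 * b * c)))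
    (hδ : ∀ α, δ α = Real.arccos ((d ^ 2 + (e α) ^ 2 - a ^ 2) / (2 * d * e α))
      + Real.arccos ((c ^ 2 + (e α) ^ 2 - b ^ 2) / (2 * c * e α)))
    (α₀ : ℝ) (hα₀ : α₀ ∈ Ioo 0 π) (he₀ : 0 < e α₀)
    (harg₁ : (a ^ 2 + (e α₀) ^ 2 - d ^ 2) / (2 * a * e α₀) ∈ Ioo (-1 : ℝ) 1)
    (harg₂ : (b ^ 2 + (e α₀) ^ 2 - c ^ 2) / (2 * b * e α₀) ∈ Ioo (-1 : ℝ) 1)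
    (harg₃ : (b ^ 2 + c ^ 2 - (e α₀) ^ 2) / (2 * b * c) ∈ Ioo (-1 : ℝ) 1)
    (harg₄ : (d ^ 2 + (e α₀) ^ 2 - a ^ 2) / (2 * d * e α₀) ∈ Ioo (-1 : ℝ) 1)
    (harg₅ : (c ^ 2 + (e α₀) ^ 2 - b ^ 2) / (2 * c * e α₀) ∈ Ioo (-1 : ℝ) 1) :
    HasDerivAt β (-(d * Real.sin (δ α₀)) / (b * Real.sin (γ α₀))) α₀ := by
  obtain ⟨hα0, hαπ⟩ := hα₀
  have hsin : 0 < Real.sin α₀ := Real.sin_pos_of_pos_of_lt_pi hα0 hαπ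
  have hrad : 0 < a ^ 2 + d ^ 2 - 2 * a * d * Real.cos α₀ :=
    Real.sqrt_pos.mp (he α₀ ▸ he₀)
  have hsq : e α₀ ^ 2 = a ^ 2 + d ^ 2 - 2 * a * d * Real.cos α₀ := by
    rw [he, Real.sq_sqrt hrad.le]
  have hde : HasDerivAt e (a * d * Real.sin α₀ / e α₀) α₀ := by
    have h := (((Real.hasDerivAt_cos α₀).const_mul (2 * a * d)).const_sub
      (a ^ 2 + d ^ 2)).sqrt hrad.ne'
    rw [← he, ← funext he] at h
    refine h.congr_deriv ?_
    field_simp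
  have hγpos : 0 < Real.sin (γ α₀) := by
    rw [hγ, Real.sin_arccos]
    exact Real.sqrt_pos.mpr (by nlinarith [harg₃.1, harg₃.2])
  have hγcos : 2 * b * c * Real.cos (γ α₀) = b ^ 2 + c ^ 2 - e α₀ ^ 2 := by
    rw [hγ, Real.cos_arccos harg₃.1.le harg₃.2.le]
    field_simp
  set K := a * d * Real.sin α₀ with hKdef
  set L := b * c * Real.sin (γ α₀) with hLdef
  have hK : 0 < K := by positivity
  have hL : 0 < L := by positivity
  have hK2 : 4 * K ^ 2 = 4 * a ^ 2 * d ^ 2 - (a ^ 2 + d ^ 2 - e α₀ ^ 2) ^ 2 := by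
    rw [hsq, hKdef]
    linear_combination 4 * a ^ 2 * d ^ 2 * Real.sin_sq_add_cos_sq α₀
  have hL2 : 4 * L ^ 2 = 4 * b ^ 2 * c ^ 2 - (b ^ 2 + c ^ 2 - e α₀ ^ 2) ^ 2 := by
    rw [← hγcos, hLdef]
    linear_combination 4 * b ^ 2 * c ^ 2 * Real.sin_sq_add_cos_sq (γ α₀)
  have hβ' := (hasDerivAt_arccos_cosine_rule (q := d) hde ha he₀ hK (by linarith)).add
    (hasDerivAt_arccos_cosine_rule (q := c) hde hb he₀ hL (by linarith))
  rw [funext hβ]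
  refine hβ'.congr_deriv ?_
  rw [hδ, Real.sin_add, Real.cos_arccos harg₄.1.le harg₄.2.le,
    Real.cos_arccos harg₅.1.le harg₅.2.le, Real.sin_arccos, Real.sin_arccos,
    sqrt_one_sub_cosine_rule_sq hd he₀ hK.le (by linarith),
    sqrt_one_sub_cosine_rule_sq hc he₀ hL.le (by linarith)]
  have hγL : Real.sin (γ α₀) = L / (b * c) := by
    rw [hLdef]
    field_simp
  rw [hγL]
  field_simp
  ring
end

section
/- Let α ∈ (0, π) and x₀ = −cos α, and suppose all the arccos arguments in the definition of g are in (−1, 1) at x₀ and that the associated interior angles β, γ, δ (given by β = arccos((a² + E(x₀)² − d²)/(2aE(x₀))) + arccos((b² + E(x₀)² − c²)/(2bE(x₀))), γ = arccos((b² + c² − E(x₀)²)/(2bc)), δ = arccos((d² + E(x₀)² − a²)/(2dE(x₀))) + arccos((c² + E(x₀)² − b²)/(2cE(x₀)))) all lie in (0, π). Then g is differentiable at x₀ with g'(x₀) = (d·sin β·sin δ)/(b·sin α·sin γ); in particular g'(x₀) > 0. -/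
open Real Set

/-- The sine of an angle given by the law of cosines, in terms of Heron's expression. -/
lemma sin_arccos_lawOfCosines {p r : ℝ} (hp : 0 < p) (hr : 0 < r) (q : ℝ) :
    Real.sin (Real.arccos ((p ^ 2 + r ^ 2 - q ^ 2) / (2 * p * r))) =
      √(4 * p ^ 2 * r ^ 2 - (p ^ 2 + r ^ 2 - q ^ 2) ^ 2) / (2 * p * r) := by
  have h : 1 - ((p ^ 2 + r ^ 2 - q ^ 2) / (2 * p * r)) ^ 2 =
      (4 * p ^ 2 * r ^ 2 - (p ^ 2 + r ^ 2 - q ^ 2) ^ 2) / (2 * p * r) ^ 2 := by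
    field_simp
    ring
  rw [Real.sin_arccos, h, Real.sqrt_div' _ (by positivity), Real.sqrt_sq (by positivity)]

/-- The law-of-cosines quotient is a cosine as soon as Heron's expression is nonnegative. -/
lemma cos_arccos_lawOfCosines {p r q : ℝ} (hp : 0 < p) (hr : 0 < r)
    (h : 0 ≤ 4 * p ^ 2 * r ^ 2 - (p ^ 2 + r ^ 2 - q ^ 2) ^ 2) :
    Real.cos (Real.arccos ((p ^ 2 + r ^ 2 - q ^ 2) / (2 * p * r))) =
      (p ^ 2 + r ^ 2 - q ^ 2) / (2 * p * r) := by
  have habs : |p ^ 2 + r ^ 2 - q ^ 2| ≤ 2 * p * r := by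
    refine abs_le_of_sq_le_sq ?_ (by positivity)
    linarith
  obtain ⟨h₁, h₂⟩ := abs_le.mp habs
  refine Real.cos_arccos ?_ ?_
  · rw [le_div_iff₀ (by positivity)]
    linarith
  · rw [div_le_one (by positivity)]
    exact h₂

/-- Heron's expression is positive when the law-of-cosines quotient lies in `(-1, 1)`. -/
lemma heron_pos_of_mem_Ioo {p r q : ℝ} (hp : 0 < p) (hr : 0 < r)
    (h : (p ^ 2 + r ^ 2 - q ^ 2) / (2 * p * r) ∈ Ioo (-1 : ℝ) 1) :
    0 < 4 * p ^ 2 * r ^ 2 - (p ^ 2 + r ^ 2 - q ^ 2) ^ 2 := by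
  obtain ⟨h₁, h₂⟩ := h
  rw [lt_div_iff₀ (by positivity)] at h₁
  rw [div_lt_one (by positivity)] at h₂
  nlinarith

/-- Derivative of an angle of a triangle with fixed sides `p`, `q` adjacent and opposite to it,
as the third side `E` varies. -/
lemma hasDerivAt_arccos_lawOfCosines {p q E' x : ℝ} {E : ℝ → ℝ} (hp : 0 < p) (hpos : 0 < E x)
    (hE : HasDerivAt E E' x)
    (h : (p ^ 2 + E x ^ 2 - q ^ 2) / (2 * p * E x) ∈ Ioo (-1 : ℝ) 1) :
    HasDerivAt (fun y ↦ Real.arccos ((p ^ 2 + E y ^ 2 - q ^ 2) / (2 * p * E y)))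
      (-(q ^ 2 + E x ^ 2 - p ^ 2) * E' /
        (E x * √(4 * p ^ 2 * E x ^ 2 - (p ^ 2 + E x ^ 2 - q ^ 2) ^ 2))) x := by
  have hS := Real.sqrt_pos.mpr (heron_pos_of_mem_Ioo hp hpos h)
  have hsin := sin_arccos_lawOfCosines hp hpos q
  have hquot := (((hE.pow 2).const_add (p ^ 2)).sub_const (q ^ 2)).div (hE.const_mul (2 * p))
    (by positivity)
  have hder := (Real.hasDerivAt_arccos h.1.ne' h.2.ne).comp x hquot
  rw [← Real.sin_arccos, hsin] at hder
  refine hder.congr_deriv ?_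
  simp only [Pi.pow_apply]
  field_simp
  ring

/-- Fix positive reals `a, b, c, d`. For `x ∈ (−1, 1)` set `E(x) = √(a² + d² + 2adx)` and
`g(x) = cos(arccos((a² + E² − d²)/(2aE)) + arccos((b² + E² − c²)/(2bE)))`.
Let `α ∈ (0, π)`, `x₀ = −cos α`, and suppose both arccos arguments in the definition of `g`
lie in `(−1, 1)` at `x₀` and the associated interior angles `β, γ, δ` all lie in `(0, π)`.
Then `g` is differentiable at `x₀` with `g'(x₀) = d sin β sin δ/(b sin α sin γ) > 0`. -/
theorem g_hasDerivAt_pos (a b c d : ℝ) (ha : 0 < a) (hb : 0 < b) (hc : 0 < c) (hd : 0 < d)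
    (E g : ℝ → ℝ)
    (hE : ∀ x, E x = Real.sqrt (a ^ 2 + d ^ 2 + 2 * a * d * x))
    (hg : ∀ x, g x = Real.cos (Real.arccos ((a ^ 2 + (E x) ^ 2 - d ^ 2) / (2 * a * E x))
      + Real.arccos ((b ^ 2 + (E x) ^ 2 - c ^ 2) / (2 * b * E x))))
    (α x₀ : ℝ) (hα : α ∈ Ioo 0 π) (hx₀ : x₀ = -Real.cos α)
    (harg₁ : (a ^ 2 + (E x₀) ^ 2 - d ^ 2) / (2 * a * E x₀) ∈ Ioo (-1 : ℝ) 1)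
    (harg₂ : (b ^ 2 + (E x₀) ^ 2 - c ^ 2) / (2 * b * E x₀) ∈ Ioo (-1 : ℝ) 1)
    (β γ δ : ℝ)
    (hβ : β = Real.arccos ((a ^ 2 + (E x₀) ^ 2 - d ^ 2) / (2 * a * E x₀))
      + Real.arccos ((b ^ 2 + (E x₀) ^ 2 - c ^ 2) / (2 * b * E x₀)))
    (hγ : γ = Real.arccos ((b ^ 2 + c ^ 2 - (E x₀) ^ 2) / (2 * b * c)))
    (hδ : δ = Real.arccos ((d ^ 2 + (E x₀) ^ 2 - a ^ 2) / (2 * d * E x₀))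
      + Real.arccos ((c ^ 2 + (E x₀) ^ 2 - b ^ 2) / (2 * c * E x₀)))
    (hβ' : β ∈ Ioo 0 π) (hγ' : γ ∈ Ioo 0 π) (hδ' : δ ∈ Ioo 0 π) :
    HasDerivAt g (d * Real.sin β * Real.sin δ / (b * Real.sin α * Real.sin γ)) x₀ ∧
      0 < d * Real.sin β * Real.sin δ / (b * Real.sin α * Real.sin γ) := by
  have hsα : 0 < Real.sin α := Real.sin_pos_of_mem_Ioo hα
  have hsβ : 0 < Real.sin β := Real.sin_pos_of_mem_Ioo hβ'
  have hsγ : 0 < Real.sin γ := Real.sin_pos_of_mem_Ioo hγ'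
  have hsδ : 0 < Real.sin δ := Real.sin_pos_of_mem_Ioo hδ'
  refine ⟨?_, by positivity⟩
  have hrad : 0 < a ^ 2 + d ^ 2 + 2 * a * d * x₀ := by
    have hcos : Real.cos α < 1 := by
      nlinarith [Real.sin_sq_add_cos_sq α, Real.cos_le_one α]
    nlinarith [mul_pos (mul_pos ha hd) (sub_pos.mpr hcos), sq_nonneg (a - d)]
  have hpos : 0 < E x₀ := by
    rw [hE]
    exact Real.sqrt_pos.mpr hrad
  have hEsq : E x₀ ^ 2 = a ^ 2 + d ^ 2 + 2 * a * d * x₀ := by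
    rw [hE, Real.sq_sqrt hrad.le]
  have hEder : HasDerivAt E (a * d / E x₀) x₀ := by
    have h := (((hasDerivAt_id x₀).const_mul (2 * a * d)).const_add (a ^ 2 + d ^ 2)).sqrt hrad.ne'
    simp only [id] at h
    rw [funext hE]
    refine h.congr_deriv ?_
    field_simp
  have hαarc : α = Real.arccos ((a ^ 2 + d ^ 2 - E x₀ ^ 2) / (2 * a * d)) := by
    have hquot : (a ^ 2 + d ^ 2 - E x₀ ^ 2) / (2 * a * d) = Real.cos α := by
      rw [hEsq, hx₀]
      field_simp
      ring
    rw [hquot, Real.arccos_cos hα.1.le hα.2.le]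
  have hH₁ := heron_pos_of_mem_Ioo ha hpos harg₁
  have hH₂ := heron_pos_of_mem_Ioo hb hpos harg₂
  have hder := ((hasDerivAt_arccos_lawOfCosines ha hpos hEder harg₁).add
    (hasDerivAt_arccos_lawOfCosines hb hpos hEder harg₂)).cos
  rw [funext hg]
  refine hder.congr_deriv ?_
  simp only [Pi.add_apply]
  rw [← hβ]
  have heron₁ : 4 * d ^ 2 * E x₀ ^ 2 - (d ^ 2 + E x₀ ^ 2 - a ^ 2) ^ 2 =
      4 * a ^ 2 * E x₀ ^ 2 - (a ^ 2 + E x₀ ^ 2 - d ^ 2) ^ 2 := by ring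
  have heron₂ : 4 * c ^ 2 * E x₀ ^ 2 - (c ^ 2 + E x₀ ^ 2 - b ^ 2) ^ 2 =
      4 * b ^ 2 * E x₀ ^ 2 - (b ^ 2 + E x₀ ^ 2 - c ^ 2) ^ 2 := by ring
  have heronα : 4 * a ^ 2 * d ^ 2 - (a ^ 2 + d ^ 2 - E x₀ ^ 2) ^ 2 =
      4 * a ^ 2 * E x₀ ^ 2 - (a ^ 2 + E x₀ ^ 2 - d ^ 2) ^ 2 := by ring
  have heronγ : 4 * b ^ 2 * c ^ 2 - (b ^ 2 + c ^ 2 - E x₀ ^ 2) ^ 2 =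
      4 * b ^ 2 * E x₀ ^ 2 - (b ^ 2 + E x₀ ^ 2 - c ^ 2) ^ 2 := by ring
  have hsinα := sin_arccos_lawOfCosines ha hd (E x₀)
  have hsinγ := sin_arccos_lawOfCosines hb hc (E x₀)
  rw [← hαarc, heronα] at hsinα
  rw [← hγ, heronγ] at hsinγ
  rw [hsinα, hsinγ, hδ, Real.sin_add, sin_arccos_lawOfCosines hd hpos,
    sin_arccos_lawOfCosines hc hpos, cos_arccos_lawOfCosines hd hpos (heron₁ ▸ hH₁.le),
    cos_arccos_lawOfCosines hc hpos (heron₂ ▸ hH₂.le), heron₁, heron₂]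
  have hS₁ := Real.sqrt_pos.mpr hH₁
  have hS₂ := Real.sqrt_pos.mpr hH₂
  generalize √(4 * a ^ 2 * E x₀ ^ 2 - (a ^ 2 + E x₀ ^ 2 - d ^ 2) ^ 2) = S₁ at hS₁ ⊢
  generalize √(4 * b ^ 2 * E x₀ ^ 2 - (b ^ 2 + E x₀ ^ 2 - c ^ 2) ^ 2) = S₂ at hS₂ ⊢
  field_simp
  ring
end

section
/- Suppose in addition that a + b = c + d and that the quadrilateral is not a parallelogram, i.e., it is not the case that both a = c and b = d. Then a·d·sin α·cot γ + a·b·sin β·cot δ + b·c·sin γ·cot α + c·d·sin δ·cot β < 0, where cot θ = cos θ / sin θ. -/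
open Real EuclideanGeometry

/-- The planar cross product of two vectors in `EuclideanSpace ℝ (Fin 2)`. -/
noncomputable def cross2 (u v : EuclideanSpace ℝ (Fin 2)) : ℝ := u 0 * v 1 - u 1 * v 0

/-- The side lengths times the sine of the angle at the middle vertex of a left turn. -/
theorem dist_mul_dist_mul_sin_angle {X Y Z : EuclideanSpace ℝ (Fin 2)}
    (h : 0 ≤ cross2 (Y - X) (Z - Y)) :
    dist X Y * dist Y Z * Real.sin (∠ X Y Z) = cross2 (Y - X) (Z - Y) := by
  have hs := InnerProductGeometry.sin_angle_mul_norm_mul_norm (X - Y) (Z - Y)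
  rw [dist_eq_norm, dist_comm Y Z, dist_eq_norm, mul_comm, EuclideanGeometry.angle,
    vsub_eq_sub, vsub_eq_sub, hs, ← Real.sqrt_sq h]
  congr 1
  simp only [PiLp.inner_apply, Fin.sum_univ_two, cross2, PiLp.sub_apply, RCLike.inner_apply,
    conj_trivial]
  ring

theorem dist_mul_dist_mul_cos_angle (X Y Z : EuclideanSpace ℝ (Fin 2)) :
    dist X Y * dist Y Z * Real.cos (∠ X Y Z)
      = (X 0 - Y 0) * (Z 0 - Y 0) + (X 1 - Y 1) * (Z 1 - Y 1) := by
  have hs := InnerProductGeometry.cos_angle_mul_norm_mul_norm (X - Y) (Z - Y)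
  rw [dist_eq_norm, dist_comm Y Z, dist_eq_norm, mul_comm, EuclideanGeometry.angle,
    vsub_eq_sub, vsub_eq_sub, hs]
  simp only [PiLp.inner_apply, Fin.sum_univ_two, PiLp.sub_apply, RCLike.inner_apply,
    conj_trivial]
  ring

theorem cos_div_sin_angle {X Y Z : EuclideanSpace ℝ (Fin 2)}
    (h : 0 < cross2 (Y - X) (Z - Y)) :
    Real.cos (∠ X Y Z) / Real.sin (∠ X Y Z)
      = ((X 0 - Y 0) * (Z 0 - Y 0) + (X 1 - Y 1) * (Z 1 - Y 1)) / cross2 (Y - X) (Z - Y) := by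
  have hs := dist_mul_dist_mul_sin_angle h.le
  have hne : dist X Y * dist Y Z ≠ 0 := by
    intro h0
    rw [h0, zero_mul] at hs
    exact h.ne hs
  rw [← hs, ← dist_mul_dist_mul_cos_angle, mul_div_mul_left _ _ hne]

/-- Two linearly independent planar vectors have no vanishing nontrivial linear combination. -/
theorem normSq_sub_pos {e₀ e₁ f₀ f₁ x y : ℝ} (hT : e₀ * f₁ - e₁ * f₀ ≠ 0)
    (hxy : ¬(x = 0 ∧ y = 0)) :
    0 < (x * f₀ - y * e₀) ^ 2 + (x * f₁ - y * e₁) ^ 2 := by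
  by_contra! hle
  have h₀ : x * f₀ - y * e₀ = 0 := by
    nlinarith [sq_nonneg (x * f₀ - y * e₀), sq_nonneg (x * f₁ - y * e₁)]
  have h₁ : x * f₁ - y * e₁ = 0 := by
    nlinarith [sq_nonneg (x * f₀ - y * e₀), sq_nonneg (x * f₁ - y * e₁)]
  refine hxy ⟨(mul_eq_zero.1 ?_).resolve_right hT, (mul_eq_zero.1 ?_).resolve_right hT⟩
  · linear_combination e₀ * h₁ - e₁ * h₀
  · linear_combination f₀ * h₁ - f₁ * h₀

/-- The cotangent inequality in the coordinates given by the diagonals `e` and `f`, which divide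
each other in the ratios `s : s'` and `t : t'`. -/
theorem diagonal_coordinates_sum_neg {e₀ e₁ f₀ f₁ s s' t t' : ℝ} (hs : 0 < s) (hs' : 0 < s')
    (ht : 0 < t) (ht' : 0 < t') (hT : e₀ * f₁ - e₁ * f₀ ≠ 0) (hne : ¬(s = s' ∧ t = t')) :
    s / s' * ((t * f₀ + s' * e₀) * (-t' * f₀ + s' * e₀)
        + (t * f₁ + s' * e₁) * (-t' * f₁ + s' * e₁))
      + t / t' * ((-s' * e₀ + t' * f₀) * (s * e₀ + t' * f₀)
        + (-s' * e₁ + t' * f₁) * (s * e₁ + t' * f₁))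
      + s' / s * ((-t' * f₀ - s * e₀) * (t * f₀ - s * e₀)
        + (-t' * f₁ - s * e₁) * (t * f₁ - s * e₁))
      + t' / t * ((s * e₀ - t * f₀) * (-s' * e₀ - t * f₀)
        + (s * e₁ - t * f₁) * (-s' * e₁ - t * f₁)) < 0 := by
  have hpos := normSq_sub_pos (x := t * t' * (s - s')) (y := s * s' * (t - t')) hT (by
    simpa [hs.ne', hs'.ne', ht.ne', ht'.ne', sub_eq_zero] using hne)
  refine lt_of_eq_of_lt ?_ (neg_neg_of_pos (div_pos hpos
    (mul_pos (mul_pos hs hs') (mul_pos ht ht'))))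
  field_simp
  ring

/-- Consider a strictly convex quadrilateral `P₁P₂P₃P₄` (vertices counterclockwise) with side
lengths `a = |P₁P₂|`, `b = |P₂P₃|`, `c = |P₃P₄|`, `d = |P₄P₁|` and interior angles
`α, β, γ, δ` at `P₁, P₂, P₃, P₄`. If `a + b = c + d` and the quadrilateral is not a
parallelogram (not both `a = c` and `b = d`), then
`ad sin α cot γ + ab sin β cot δ + bc sin γ cot α + cd sin δ cot β < 0`. -/
theorem quad_cot_sum_neg (P₁ P₂ P₃ P₄ : EuclideanSpace ℝ (Fin 2))
    (hccw₁ : 0 < cross2 (P₂ - P₁) (P₃ - P₂))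
    (hccw₂ : 0 < cross2 (P₃ - P₂) (P₄ - P₃))
    (hccw₃ : 0 < cross2 (P₄ - P₃) (P₁ - P₄))
    (hccw₄ : 0 < cross2 (P₁ - P₄) (P₂ - P₁))
    (a b c d α β γ δ : ℝ)
    (ha : a = dist P₁ P₂) (hb : b = dist P₂ P₃) (hc : c = dist P₃ P₄) (hd : d = dist P₄ P₁)
    (hα : α = ∠ P₄ P₁ P₂) (hβ : β = ∠ P₁ P₂ P₃) (hγ : γ = ∠ P₂ P₃ P₄) (hδ : δ = ∠ P₃ P₄ P₁)
    (hsum : a + b = c + d)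
    (hnotpar : ¬(a = c ∧ b = d)) :
    a * d * Real.sin α * (Real.cos γ / Real.sin γ)
      + a * b * Real.sin β * (Real.cos δ / Real.sin δ)
      + b * c * Real.sin γ * (Real.cos α / Real.sin α)
      + c * d * Real.sin δ * (Real.cos β / Real.sin β) < 0 := by
  have hA₁ := dist_mul_dist_mul_sin_angle hccw₄.le
  have hA₂ := dist_mul_dist_mul_sin_angle hccw₁.le
  have hA₃ := dist_mul_dist_mul_sin_angle hccw₂.le
  have hA₄ := dist_mul_dist_mul_sin_angle hccw₃.le
  have hC₁ := cos_div_sin_angle hccw₄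
  have hC₂ := cos_div_sin_angle hccw₁
  have hC₃ := cos_div_sin_angle hccw₂
  have hC₄ := cos_div_sin_angle hccw₃
  rw [← hα, ← hd, ← ha, mul_comm d a] at hA₁
  rw [← hβ, ← ha, ← hb] at hA₂
  rw [← hγ, ← hb, ← hc] at hA₃
  rw [← hδ, ← hc, ← hd] at hA₄
  rw [← hα] at hC₁
  rw [← hβ] at hC₂
  rw [← hγ] at hC₃
  rw [← hδ] at hC₄
  rw [hA₁, hA₂, hA₃, hA₄, hC₁, hC₂, hC₃, hC₄]
  have hpar : ¬(P₁ 0 - P₂ 0 = P₄ 0 - P₃ 0 ∧ P₁ 1 - P₂ 1 = P₄ 1 - P₃ 1) := by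
    rintro ⟨h₀, h₁⟩
    refine hnotpar ⟨?_, ?_⟩
    · rw [ha, hc, dist_comm P₃, EuclideanSpace.dist_eq, EuclideanSpace.dist_eq]
      simp only [Fin.sum_univ_two, Real.dist_eq, h₀, h₁]
    · rw [hb, hd, dist_comm P₄, EuclideanSpace.dist_eq, EuclideanSpace.dist_eq]
      have h₀' : P₂ 0 - P₃ 0 = P₁ 0 - P₄ 0 := by linear_combination -h₀
      have h₁' : P₂ 1 - P₃ 1 = P₁ 1 - P₄ 1 := by linear_combination -h₁
      simp only [Fin.sum_univ_two, Real.dist_eq, h₀', h₁']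
  set A₁ := cross2 (P₁ - P₄) (P₂ - P₁) with hdA₁
  set A₂ := cross2 (P₂ - P₁) (P₃ - P₂) with hdA₂
  set A₃ := cross2 (P₃ - P₂) (P₄ - P₃) with hdA₃
  set A₄ := cross2 (P₄ - P₃) (P₁ - P₄) with hdA₄
  simp only [cross2, PiLp.sub_apply] at hdA₁ hdA₂ hdA₃ hdA₄
  set T := (P₁ 0 - P₃ 0) * (P₂ 1 - P₄ 1) - (P₁ 1 - P₃ 1) * (P₂ 0 - P₄ 0) with hdT
  have hT₁ : T = A₁ + A₃ := by rw [hdT, hdA₁, hdA₃]; ring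
  have hT₂ : T = A₂ + A₄ := by rw [hdT, hdA₂, hdA₄]; ring
  have hT : 0 < T := by linarith
  have hs : A₁ / T + A₃ / T = 1 := by rw [← add_div, ← hT₁, div_self hT.ne']
  have ht : A₂ / T + A₄ / T = 1 := by rw [← add_div, ← hT₂, div_self hT.ne']
  have h₁₂ : ∀ i, P₁ i - P₂ i = A₁ / T * (P₁ i - P₃ i) - A₂ / T * (P₂ i - P₄ i) := by
    rw [Fin.forall_fin_two]
    constructor <;> field_simp <;> rw [hdT, hdA₁, hdA₂] <;> ring
  have hne : ¬(A₁ / T = A₃ / T ∧ A₂ / T = A₄ / T) := by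
    rintro ⟨h₁, h₂⟩
    have h₁' : A₁ / T = 1 / 2 := by linarith
    have h₂' : A₂ / T = 1 / 2 := by linarith
    rw [h₁', h₂'] at h₁₂
    exact hpar ⟨by linarith [h₁₂ 0], by linarith [h₁₂ 1]⟩
  have key := diagonal_coordinates_sum_neg (div_pos hccw₄ hT) (div_pos hccw₂ hT)
    (div_pos hccw₁ hT) (div_pos hccw₃ hT) hT.ne' hne
  rw [div_div_div_cancel_right₀ hT.ne', div_div_div_cancel_right₀ hT.ne',
    div_div_div_cancel_right₀ hT.ne', div_div_div_cancel_right₀ hT.ne'] at key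
  have h₂₁ (i) : P₂ i - P₁ i = A₂ / T * (P₂ i - P₄ i) - A₁ / T * (P₁ i - P₃ i) := by
    linear_combination -h₁₂ i
  have h₂₃ (i) : P₂ i - P₃ i = A₂ / T * (P₂ i - P₄ i) + A₃ / T * (P₁ i - P₃ i) := by
    linear_combination -h₁₂ i - (P₁ i - P₃ i) * hs
  have h₃₂ (i) : P₃ i - P₂ i = -(A₃ / T) * (P₁ i - P₃ i) - A₂ / T * (P₂ i - P₄ i) := by
    linear_combination h₁₂ i + (P₁ i - P₃ i) * hs
  have h₄₃ (i) : P₄ i - P₃ i = -(A₄ / T) * (P₂ i - P₄ i) + A₃ / T * (P₁ i - P₃ i) := by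
    linear_combination -h₁₂ i - (P₁ i - P₃ i) * hs + (P₂ i - P₄ i) * ht
  have h₃₄ (i) : P₃ i - P₄ i = -(A₃ / T) * (P₁ i - P₃ i) + A₄ / T * (P₂ i - P₄ i) := by
    linear_combination h₁₂ i + (P₁ i - P₃ i) * hs - (P₂ i - P₄ i) * ht
  have h₁₄ (i) : P₁ i - P₄ i = A₁ / T * (P₁ i - P₃ i) + A₄ / T * (P₂ i - P₄ i) := by
    linear_combination h₁₂ i - (P₂ i - P₄ i) * ht
  have h₄₁ (i) : P₄ i - P₁ i = -(A₄ / T) * (P₂ i - P₄ i) - A₁ / T * (P₁ i - P₃ i) := by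
    linear_combination -h₁₂ i + (P₂ i - P₄ i) * ht
  rw [h₁₂ 0, h₂₁ 0, h₂₃ 0, h₃₂ 0, h₃₄ 0, h₄₃ 0, h₁₄ 0, h₄₁ 0,
    h₁₂ 1, h₂₁ 1, h₂₃ 1, h₃₂ 1, h₃₄ 1, h₄₃ 1, h₁₄ 1, h₄₁ 1]
  refine lt_of_eq_of_lt ?_ key
  ring
end

section
/- Suppose a + b = c + d and it is not the case that both a = c and b = d. Then for every x in the open set of points of (−1, 1) at which all arccos arguments in the definition of g lie in (−1, 1) and the associated quadrilateral is strictly convex (all four interior angles α = arccos(−x), β, γ, δ lie in (0, π)), the second derivative of g at x is strictly positive; consequently g is strictly convex and g' is strictly increasing on every interval contained in this set. -/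
open Real Set

open Filter Topology

/-- `4ab` times the cosine of the angle between the sides `a` and `b`, as a function of the squared
diagonal `u`, where `t = a - d = c - b`, `A = a + d` and `B = b + c`. -/
noncomputable def diagCos (t A B u : ℝ) : ℝ :=
  u + t * (A - B) - t ^ 2 * A * B / u - (1 - t ^ 2 / u) * √((A ^ 2 - u) * (B ^ 2 - u))

/-- The first derivative of `diagCos`. -/
noncomputable def diagCosDeriv (t A B u : ℝ) : ℝ :=
  1 + t ^ 2 * A * B / u ^ 2 - (t ^ 2 / u ^ 2 * √((A ^ 2 - u) * (B ^ 2 - u))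
    + (1 - t ^ 2 / u) * ((2 * u - A ^ 2 - B ^ 2) / (2 * √((A ^ 2 - u) * (B ^ 2 - u)))))

/-- The second derivative of `diagCos`. -/
noncomputable def diagCosDeriv2 (t A B u : ℝ) : ℝ :=
  t ^ 2 / (u ^ 3 * √((A ^ 2 - u) * (B ^ 2 - u))) *
      (2 * A ^ 2 * B ^ 2 - u * (A ^ 2 + B ^ 2) - 2 * A * B * √((A ^ 2 - u) * (B ^ 2 - u)))
    + (1 - t ^ 2 / u) * ((A ^ 2 - B ^ 2) ^ 2 / (4 * √((A ^ 2 - u) * (B ^ 2 - u)) ^ 3))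

section diagCos

variable {t A B u : ℝ}

lemma hasDerivAt_sqrt_sub_mul_sub (hA : u < A ^ 2) (hB : u < B ^ 2) :
    HasDerivAt (fun v ↦ √((A ^ 2 - v) * (B ^ 2 - v)))
      ((2 * u - A ^ 2 - B ^ 2) / (2 * √((A ^ 2 - u) * (B ^ 2 - u)))) u := by
  have h := (((hasDerivAt_id u).const_sub (A ^ 2)).mul ((hasDerivAt_id u).const_sub (B ^ 2))).sqrt
    (mul_pos (sub_pos.2 hA) (sub_pos.2 hB)).ne'
  refine h.congr_deriv ?_
  simp only [id, Pi.mul_apply]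
  congr 1
  ring

lemma hasDerivAt_const_div (k : ℝ) (hu : 0 < u) :
    HasDerivAt (fun v ↦ k / v) (-k / u ^ 2) u := by
  refine (((hasDerivAt_const u k).div (hasDerivAt_id u) hu.ne')).congr_deriv ?_
  simp

lemma hasDerivAt_diagCos (hu : 0 < u) (hA : u < A ^ 2) (hB : u < B ^ 2) :
    HasDerivAt (diagCos t A B) (diagCosDeriv t A B u) u := by
  have h := (((hasDerivAt_id u).add_const (t * (A - B))).sub
    (hasDerivAt_const_div (t ^ 2 * A * B) hu)).sub
    (((hasDerivAt_const_div (t ^ 2) hu).const_sub 1).mul (hasDerivAt_sqrt_sub_mul_sub hA hB))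
  refine h.congr_deriv ?_
  rw [diagCosDeriv]
  ring

lemma hasDerivAt_diagCosDeriv (hu : 0 < u) (hA : u < A ^ 2) (hB : u < B ^ 2) :
    HasDerivAt (diagCosDeriv t A B) (diagCosDeriv2 t A B u) u := by
  have hs : 0 < √((A ^ 2 - u) * (B ^ 2 - u)) :=
    Real.sqrt_pos.2 (mul_pos (sub_pos.2 hA) (sub_pos.2 hB))
  have hs2 : √((A ^ 2 - u) * (B ^ 2 - u)) ^ 2 = (A ^ 2 - u) * (B ^ 2 - u) :=
    Real.sq_sqrt (mul_pos (sub_pos.2 hA) (sub_pos.2 hB)).le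
  have hr := hasDerivAt_sqrt_sub_mul_sub hA hB
  have hsq (k : ℝ) : HasDerivAt (fun v ↦ k / v ^ 2) (-2 * k / u ^ 3) u := by
    refine ((hasDerivAt_const u k).div (hasDerivAt_pow 2 u) (pow_pos hu 2).ne').congr_deriv ?_
    simp only [Nat.cast_ofNat]
    field_simp
    ring
  have hlin : HasDerivAt (fun v ↦ 2 * v - A ^ 2 - B ^ 2) 2 u := by
    simpa using (((hasDerivAt_id u).const_mul 2).sub_const (A ^ 2)).sub_const (B ^ 2)
  have h := ((hsq (t ^ 2 * A * B)).const_add 1).sub (((hsq (t ^ 2)).mul hr).add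
    (((hasDerivAt_const_div (t ^ 2) hu).const_sub 1).mul
      (hlin.div (hr.const_mul 2) (by positivity))))
  refine h.congr_deriv ?_
  rw [diagCosDeriv2]
  simp only [Pi.div_apply]
  generalize √((A ^ 2 - u) * (B ^ 2 - u)) = s at *
  field_simp
  linear_combination (32 * t ^ 2 * s ^ 2 - 16 * u ^ 2 * (u - t ^ 2)) * hs2

lemma diagCosDeriv2_pos (hA0 : 0 < A) (hB0 : 0 < B) (hAB : A ≠ B) (ht : t ^ 2 < u)
    (hA : u < A ^ 2) (hB : u < B ^ 2) : 0 < diagCosDeriv2 t A B u := by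
  have hu : 0 < u := (sq_nonneg t).trans_lt ht
  have hs : 0 < √((A ^ 2 - u) * (B ^ 2 - u)) :=
    Real.sqrt_pos.2 (mul_pos (sub_pos.2 hA) (sub_pos.2 hB))
  have hs2 : √((A ^ 2 - u) * (B ^ 2 - u)) ^ 2 = (A ^ 2 - u) * (B ^ 2 - u) :=
    Real.sq_sqrt (mul_pos (sub_pos.2 hA) (sub_pos.2 hB)).le
  rw [diagCosDeriv2]
  generalize √((A ^ 2 - u) * (B ^ 2 - u)) = s at *
  refine add_pos_of_nonneg_of_pos (mul_nonneg (by positivity) (sub_nonneg.2 ?_)) ?_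
  · refine le_of_sq_le_sq ?_ ?_
    · rw [mul_pow, hs2]
      nlinarith [sq_nonneg (u * (A ^ 2 - B ^ 2))]
    · nlinarith [mul_pos (pow_pos hA0 2) (sub_pos.2 hB), mul_pos (pow_pos hB0 2) (sub_pos.2 hA)]
  · have h1 : 0 < 1 - t ^ 2 / u := sub_pos.2 ((div_lt_one hu).2 ht)
    have h2 : A ^ 2 - B ^ 2 ≠ 0 := by
      rw [sq_sub_sq]
      exact mul_ne_zero (by positivity) (sub_ne_zero.2 hAB)
    positivity

end diagCos

/-- The law of cosines: the cosine of the sum of the angles at a common vertex of two triangles glued along a diagonal with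
square `u`, for side lengths with `a + b = c + d`. -/
lemma cos_arccos_add_arccos_eq_diagCos {a b c d u : ℝ} (ha : 0 < a) (hb : 0 < b)
    (hsum : a + b = c + d) (ht : (a - d) ^ 2 < u) (hA : u < (a + d) ^ 2) (hB : u < (b + c) ^ 2) :
    cos (arccos ((a ^ 2 + √u ^ 2 - d ^ 2) / (2 * a * √u))
      + arccos ((b ^ 2 + √u ^ 2 - c ^ 2) / (2 * b * √u)))
      = diagCos (a - d) (a + d) (b + c) u / (4 * a * b) := by
  have hu : 0 < u := (sq_nonneg _).trans_lt ht
  have hs : 0 < √u := Real.sqrt_pos.2 hu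
  have hs2 : √u ^ 2 = u := Real.sq_sqrt hu.le
  have key (p q : ℝ) (hp : 0 < p) (hpq : (p - q) ^ 2 = (a - d) ^ 2) :
      1 - ((p ^ 2 + √u ^ 2 - q ^ 2) / (2 * p * √u)) ^ 2
        = (u - (a - d) ^ 2) * ((p + q) ^ 2 - u) / (4 * p ^ 2 * u) := by
    rw [← hpq, div_pow, mul_pow, hs2]
    field_simp
    ring
  have h1 := key a d ha rfl
  have h2 := key b c hb (by rw [show b - c = -(a - d) by linarith, neg_sq])
  have hle (y z : ℝ) (h : 1 - y ^ 2 = z) (hz : 0 ≤ z) : -1 ≤ y ∧ y ≤ 1 :=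
    abs_le.1 (abs_le_one_iff_mul_self_le_one.2 (by nlinarith))
  have hut : 0 < u - (a - d) ^ 2 := sub_pos.2 ht
  have huA : 0 < (a + d) ^ 2 - u := sub_pos.2 hA
  have huB : 0 < (b + c) ^ 2 - u := sub_pos.2 hB
  obtain ⟨h3, h4⟩ := hle _ _ h1 (by positivity)
  obtain ⟨h5, h6⟩ := hle _ _ h2 (by positivity)
  rw [cos_add, cos_arccos h3 h4, cos_arccos h5 h6, sin_arccos, sin_arccos, h1, h2,
    ← Real.sqrt_mul (by positivity),
    show (u - (a - d) ^ 2) * ((a + d) ^ 2 - u) / (4 * a ^ 2 * u) *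
      ((u - (a - d) ^ 2) * ((b + c) ^ 2 - u) / (4 * b ^ 2 * u))
      = ((u - (a - d) ^ 2) / (4 * a * b * u)) ^ 2 * (((a + d) ^ 2 - u) * ((b + c) ^ 2 - u)) by
        field_simp,
    Real.sqrt_mul (by positivity), Real.sqrt_sq (by positivity), diagCos, hs2,
    div_mul_div_comm, show 2 * a * √u * (2 * b * √u) = 4 * a * b * √u ^ 2 by ring, hs2]
  obtain rfl : c = a + b - d := by linarith
  field_simp
  ring

/-- A cosine given by the law of cosines lies in `(-1, 1)` only if the triangle inequalities hold
strictly. -/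
lemma triangle_of_cos_mem_Ioo {p q u : ℝ} (hp : 0 < p) (hq : 0 < q) (hu : 0 < u)
    (h : (p ^ 2 + √u ^ 2 - q ^ 2) / (2 * p * √u) ∈ Ioo (-1 : ℝ) 1) :
    (p - q) ^ 2 < u ∧ u < (p + q) ^ 2 := by
  have hs : 0 < √u := Real.sqrt_pos.2 hu
  have hs2 : √u ^ 2 = u := Real.sq_sqrt hu.le
  obtain ⟨h1, h2⟩ := h
  rw [lt_div_iff₀ (by positivity)] at h1
  rw [div_lt_iff₀ (by positivity)] at h2
  constructor
  · rw [← hs2]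
    refine sq_lt_sq' ?_ ?_ <;> nlinarith
  · rw [← hs2]
    refine sq_lt_sq' ?_ ?_ <;> nlinarith

/-- Fix positive reals `a, b, c, d` with `a + b = c + d` and not both `a = c`, `b = d`.
For `x ∈ (−1, 1)` set `E(x) = √(a² + d² + 2adx)` and
`g(x) = cos(arccos((a² + E² − d²)/(2aE)) + arccos((b² + E² − c²)/(2bE)))`.
Let `U` be the set of points `x ∈ (−1, 1)` at which both arccos arguments in the definition
of `g` lie in `(−1, 1)` and the four interior angles `α = arccos(−x)`,
`β = arccos((a² + E² − d²)/(2aE)) + arccos((b² + E² − c²)/(2bE))`,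
`γ = arccos((b² + c² − E²)/(2bc))` and `δ = 2π − α − β − γ` are all in `(0, π)`.
Then the second derivative of `g` is strictly positive on `U`, and consequently `g` is
strictly convex, with strictly increasing derivative, on every interval contained in `U`. -/
theorem g_strictConvex_of_not_parallelogram (a b c d : ℝ)
    (ha : 0 < a) (hb : 0 < b) (hc : 0 < c) (hd : 0 < d)
    (hsum : a + b = c + d) (hnotpar : ¬(a = c ∧ b = d))
    (E g : ℝ → ℝ)
    (hE : ∀ x, E x = Real.sqrt (a ^ 2 + d ^ 2 + 2 * a * d * x))
    (hg : ∀ x, g x = Real.cos (Real.arccos ((a ^ 2 + (E x) ^ 2 - d ^ 2) / (2 * a * E x))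
      + Real.arccos ((b ^ 2 + (E x) ^ 2 - c ^ 2) / (2 * b * E x))))
    (U : Set ℝ)
    (hU : U = {x : ℝ | x ∈ Ioo (-1 : ℝ) 1 ∧
      (a ^ 2 + (E x) ^ 2 - d ^ 2) / (2 * a * E x) ∈ Ioo (-1 : ℝ) 1 ∧
      (b ^ 2 + (E x) ^ 2 - c ^ 2) / (2 * b * E x) ∈ Ioo (-1 : ℝ) 1 ∧
      Real.arccos (-x) ∈ Ioo 0 π ∧
      (Real.arccos ((a ^ 2 + (E x) ^ 2 - d ^ 2) / (2 * a * E x))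
        + Real.arccos ((b ^ 2 + (E x) ^ 2 - c ^ 2) / (2 * b * E x))) ∈ Ioo 0 π ∧
      Real.arccos ((b ^ 2 + c ^ 2 - (E x) ^ 2) / (2 * b * c)) ∈ Ioo 0 π ∧
      (2 * π - Real.arccos (-x)
        - (Real.arccos ((a ^ 2 + (E x) ^ 2 - d ^ 2) / (2 * a * E x))
           + Real.arccos ((b ^ 2 + (E x) ^ 2 - c ^ 2) / (2 * b * E x)))
        - Real.arccos ((b ^ 2 + c ^ 2 - (E x) ^ 2) / (2 * b * c))) ∈ Ioo 0 π}) :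
    (∀ x ∈ U, 0 < deriv (deriv g) x) ∧
    ∀ s : Set ℝ, s ⊆ U → Convex ℝ s →
      StrictConvexOn ℝ s g ∧ StrictMonoOn (deriv g) s := by
  set u : ℝ → ℝ := fun x ↦ a ^ 2 + d ^ 2 + 2 * a * d * x with hu
  set V : Set ℝ := {x | (a - d) ^ 2 < u x ∧ u x < (a + d) ^ 2 ∧ u x < (b + c) ^ 2} with hV
  have hucont : Continuous u := by fun_prop
  have hVopen : IsOpen V :=
    (isOpen_lt continuous_const hucont).inter
      ((isOpen_lt hucont continuous_const).inter (isOpen_lt hucont continuous_const))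
  have hUV : U ⊆ V := by
    intro x hx
    rw [hU] at hx
    obtain ⟨⟨hx1, -⟩, h1, h2, -⟩ := hx
    have had : 0 < a * d := mul_pos ha hd
    have hux : 0 < u x := by
      simp only [hu]
      nlinarith [sq_nonneg (a - d)]
    rw [hE] at h1 h2
    obtain ⟨h3, h4⟩ := triangle_of_cos_mem_Ioo ha hd hux h1
    exact ⟨h3, h4, (triangle_of_cos_mem_Ioo hb hc hux h2).2⟩
  have hAB : a + d ≠ b + c := fun h ↦ hnotpar ⟨by linarith, by linarith⟩
  have huderiv (x : ℝ) : HasDerivAt u (2 * a * d) x :=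
    (((hasDerivAt_id x).const_mul (2 * a * d)).const_add (a ^ 2 + d ^ 2)).congr_deriv (mul_one _)
  have hgV : EqOn g (fun x ↦ diagCos (a - d) (a + d) (b + c) (u x) / (4 * a * b)) V := by
    rintro x ⟨h1, h2, h3⟩
    rw [hg, hE]
    exact cos_arccos_add_arccos_eq_diagCos ha hb hsum h1 h2 h3
  have hg' : ∀ x ∈ V, HasDerivAt g
      (diagCosDeriv (a - d) (a + d) (b + c) (u x) * (2 * a * d) / (4 * a * b)) x := by
    intro x hx
    obtain ⟨h1, h2, h3⟩ := id hx
    exact (((hasDerivAt_diagCos ((sq_nonneg _).trans_lt h1) h2 h3).comp x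
      (huderiv x)).div_const _).congr_of_eventuallyEq (hgV.eventuallyEq_of_mem (hVopen.mem_nhds hx))
  have hg'' : ∀ x ∈ V, HasDerivAt (deriv g)
      (diagCosDeriv2 (a - d) (a + d) (b + c) (u x) * (2 * a * d) * (2 * a * d) / (4 * a * b)) x := by
    intro x hx
    obtain ⟨h1, h2, h3⟩ := id hx
    have hEq : EqOn (deriv g) (fun x ↦
        diagCosDeriv (a - d) (a + d) (b + c) (u x) * (2 * a * d) / (4 * a * b)) V :=
      fun y hy ↦ (hg' y hy).deriv
    exact ((((hasDerivAt_diagCosDeriv ((sq_nonneg _).trans_lt h1) h2 h3).comp x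
      (huderiv x)).mul_const _).div_const _).congr_of_eventuallyEq
        (hEq.eventuallyEq_of_mem (hVopen.mem_nhds hx))
  have hpos : ∀ x ∈ V, 0 < deriv (deriv g) x := by
    intro x hx
    obtain ⟨h1, h2, h3⟩ := id hx
    rw [(hg'' x hx).deriv]
    have := diagCosDeriv2_pos (add_pos ha hd) (add_pos hb hc) hAB h1 h2 h3
    positivity
  refine ⟨fun x hx ↦ hpos x (hUV hx), fun s hs hconv ↦ ⟨?_, ?_⟩⟩
  · exact strictConvexOn_of_deriv2_pos hconv
      (fun x hx ↦ (hg' x (hUV (hs hx))).continuousAt.continuousWithinAt)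
      fun x hx ↦ hpos x (hUV (hs (interior_subset hx)))
  · exact strictMonoOn_of_deriv_pos hconv
      (fun x hx ↦ (hg'' x (hUV (hs hx))).continuousAt.continuousWithinAt)
      fun x hx ↦ hpos x (hUV (hs (interior_subset hx)))
end

section
/- Let α ∈ (0, π), x₀ = −cos α, and suppose all arccos arguments in the definitions below are in (−1, 1) at x₀ and that the associated interior angles β, γ, δ all lie in (0, π). Then g is twice differentiable at x₀ with g''(x₀) = k·( −a·d·sin α·cot γ − a·b·sin β·cot δ − b·c·sin γ·cot α − c·d·sin δ·cot β ), where k = d·sin β·sin δ / (b²·c·sin²α·sin²γ). -/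
open Real Set

/-- The squared diagonal separating the sides `a, d` from the sides `b, c`, when `-x` is the cosine
of the angle between `a` and `d`. -/
noncomputable def diagSq (a d x : ℝ) : ℝ := a ^ 2 + d ^ 2 + 2 * a * d * x

/-- The cosine of the angle between `b` and `c`. -/
noncomputable def oppCos (a b c d x : ℝ) : ℝ := (b ^ 2 + c ^ 2 - diagSq a d x) / (2 * b * c)

/-- The sine of the angle between `a` and `b`, where `x` and `y` are, up to sign, the cosines of
the angles between `a, d` and `b, c`. -/
noncomputable def sinAdj (a b c d x y : ℝ) : ℝ :=
  (d * √(1 - x ^ 2) * (b - c * y) + (a + d * x) * (c * √(1 - y ^ 2))) / diagSq a d x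

/-- The cosine of the angle between `a` and `b`, where `x` and `y` are, up to sign, the cosines of
the angles between `a, d` and `b, c`. -/
noncomputable def cosAdj (a b c d x y : ℝ) : ℝ :=
  ((a + d * x) * (b - c * y) - d * √(1 - x ^ 2) * (c * √(1 - y ^ 2))) / diagSq a d x

lemma diagSq_comm (a d x : ℝ) : diagSq a d x = diagSq d a x := by
  unfold diagSq; ring

lemma oppCos_comm (a b c d x : ℝ) : oppCos a b c d x = oppCos d c b a x := by
  rw [oppCos, oppCos, diagSq_comm]; ring

lemma diagSq_eq_of_oppCos {a b c d x : ℝ} (hb : 0 < b) (hc : 0 < c) :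
    diagSq a d x = b ^ 2 + c ^ 2 - 2 * b * c * oppCos a b c d x := by
  unfold oppCos; field_simp; ring

lemma diagSq_pos {a d x : ℝ} (ha : 0 < a) (hd : 0 < d) (hx : x ^ 2 < 1) : 0 < diagSq a d x := by
  have h : -1 < x := (abs_lt.1 ((sq_lt_one_iff_abs_lt_one x).1 hx)).1
  unfold diagSq
  nlinarith [mul_pos (mul_pos ha hd) (by linarith : 0 < 1 + x), sq_nonneg (a - d)]

lemma hasDerivAt_diagSq (a d x : ℝ) : HasDerivAt (diagSq a d) (2 * a * d) x :=
  (((hasDerivAt_id x).const_mul (2 * a * d)).const_add (a ^ 2 + d ^ 2)).congr_deriv (mul_one _)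

lemma hasDerivAt_oppCos {b c : ℝ} (a d x : ℝ) (hb : 0 < b) (hc : 0 < c) :
    HasDerivAt (oppCos a b c d) (-(a * d) / (b * c)) x := by
  refine (((hasDerivAt_diagSq a d x).const_sub (b ^ 2 + c ^ 2)).div_const (2 * b * c)).congr_deriv
    ?_
  field_simp

lemma HasDerivAt.sqrt_one_sub_sq {f : ℝ → ℝ} {f' x : ℝ} (hf : HasDerivAt f f' x)
    (h : f x ^ 2 < 1) :
    HasDerivAt (fun t => √(1 - f t ^ 2)) (-(f x * f') / √(1 - f x ^ 2)) x := by
  refine (((hf.pow 2).const_sub 1).sqrt (by simpa using (sub_pos.2 h).ne')).congr_deriv ?_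
  have := sqrt_pos.2 (sub_pos.2 h)
  simp only [Pi.pow_apply]
  field_simp
  ring

lemma hasDerivAt_sinAdj {a b c d x : ℝ} (ha : 0 < a) (hb : 0 < b) (hc : 0 < c) (hd : 0 < d)
    (hx : x ^ 2 < 1) (hy : oppCos a b c d x ^ 2 < 1) :
    HasDerivAt (fun t => sinAdj a b c d t (oppCos a b c d t))
      (-(cosAdj a b c d x (oppCos a b c d x) * (d * sinAdj d c b a x (oppCos a b c d x))
        / (b * √(1 - x ^ 2) * √(1 - oppCos a b c d x ^ 2)))) x := by
  have hy' := hasDerivAt_oppCos a d x hb hc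
  have hu' := (hasDerivAt_id x).sqrt_one_sub_sq hx
  have hv' := hy'.sqrt_one_sub_sq hy
  have hs := diagSq_pos ha hd hx
  refine ((((hu'.const_mul d).mul ((hy'.const_mul c).const_sub b)).add
    ((((hasDerivAt_id x).const_mul d).const_add a).mul (hv'.const_mul c))).div
    (hasDerivAt_diagSq a d x) hs.ne').congr_deriv ?_
  have hs₁ : diagSq a d x = a ^ 2 + d ^ 2 + 2 * a * d * x := rfl
  have hs₂ := diagSq_eq_of_oppCos (a := a) (d := d) (x := x) hb hc
  have hu := sqrt_pos.2 (sub_pos.2 hx)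
  have hv := sqrt_pos.2 (sub_pos.2 hy)
  have hu₂ := sq_sqrt (sub_pos.2 hx).le
  have hv₂ := sq_sqrt (sub_pos.2 hy).le
  simp only [sinAdj, cosAdj, diagSq_comm d a, id, Pi.add_apply, Pi.mul_apply]
  clear hy' hu' hv'
  generalize √(1 - x ^ 2) = u at *
  generalize oppCos a b c d x = y at *
  generalize √(1 - y ^ 2) = v at *
  generalize diagSq a d x = s at *
  field_simp
  grind

lemma hasDerivAt_cosAdj {a b c d x : ℝ} (ha : 0 < a) (hb : 0 < b) (hc : 0 < c) (hd : 0 < d)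
    (hx : x ^ 2 < 1) (hy : oppCos a b c d x ^ 2 < 1) :
    HasDerivAt (fun t => cosAdj a b c d t (oppCos a b c d t))
      (sinAdj a b c d x (oppCos a b c d x) * (d * sinAdj d c b a x (oppCos a b c d x))
        / (b * √(1 - x ^ 2) * √(1 - oppCos a b c d x ^ 2))) x := by
  have hy' := hasDerivAt_oppCos a d x hb hc
  have hu' := (hasDerivAt_id x).sqrt_one_sub_sq hx
  have hv' := hy'.sqrt_one_sub_sq hy
  have hs := diagSq_pos ha hd hx
  refine ((((((hasDerivAt_id x).const_mul d).const_add a).mul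
    ((hy'.const_mul c).const_sub b)).sub ((hu'.const_mul d).mul (hv'.const_mul c))).div
    (hasDerivAt_diagSq a d x) hs.ne').congr_deriv ?_
  have hs₁ : diagSq a d x = a ^ 2 + d ^ 2 + 2 * a * d * x := rfl
  have hs₂ := diagSq_eq_of_oppCos (a := a) (d := d) (x := x) hb hc
  have hu := sqrt_pos.2 (sub_pos.2 hx)
  have hv := sqrt_pos.2 (sub_pos.2 hy)
  have hu₂ := sq_sqrt (sub_pos.2 hx).le
  have hv₂ := sq_sqrt (sub_pos.2 hy).le
  simp only [sinAdj, diagSq_comm d a, id, Pi.sub_apply, Pi.mul_apply]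
  clear hy' hu' hv'
  generalize √(1 - x ^ 2) = u at *
  generalize oppCos a b c d x = y at *
  generalize √(1 - y ^ 2) = v at *
  generalize diagSq a d x = s at *
  field_simp
  grind

/-- Second derivative of the cosine of the angle between `a` and `b`. -/
lemma hasDerivAt_deriv_cosAdj {a b c d x : ℝ} (ha : 0 < a) (hb : 0 < b) (hc : 0 < c) (hd : 0 < d)
    (hx : x ^ 2 < 1) (hy : oppCos a b c d x ^ 2 < 1) {y u v sβ cβ sδ cδ : ℝ}
    (hy_def : y = oppCos a b c d x) (hu_def : u = √(1 - x ^ 2)) (hv_def : v = √(1 - y ^ 2))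
    (hsβ : sβ = sinAdj a b c d x y) (hcβ : cβ = cosAdj a b c d x y)
    (hsδ : sδ = sinAdj d c b a x y) (hcδ : cδ = cosAdj d c b a x y)
    (hβ : sβ ≠ 0) (hδ : sδ ≠ 0) :
    HasDerivAt (fun t => sinAdj a b c d t (oppCos a b c d t) *
        (d * sinAdj d c b a t (oppCos a b c d t)) /
        (b * √(1 - t ^ 2) * √(1 - oppCos a b c d t ^ 2)))
      (d * sβ * sδ / (b ^ 2 * c * u ^ 2 * v ^ 2) *
        (-(a * d * u * (y / v)) - a * b * sβ * (cδ / sδ) - b * c * v * (-x / u)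
          - c * d * sδ * (cβ / sβ))) x := by
  have hu' := (hasDerivAt_id x).sqrt_one_sub_sq hx
  have hv' := (hasDerivAt_oppCos a d x hb hc).sqrt_one_sub_sq hy
  have hsβ' := hasDerivAt_sinAdj ha hb hc hd hx hy
  have hsδ' := hasDerivAt_sinAdj hd hc hb ha hx (by rwa [oppCos_comm] at hy)
  simp only [← oppCos_comm a b c d] at hsδ'
  have hu := sqrt_pos.2 (sub_pos.2 hx)
  have hv := sqrt_pos.2 (sub_pos.2 hy)
  refine ((hsβ'.mul (hsδ'.const_mul d)).div ((hu'.const_mul b).mul hv')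
    (mul_pos (mul_pos hb hu) hv).ne').congr_deriv ?_
  simp only [id, Pi.mul_apply]
  rw [← hy_def] at hv ⊢
  rw [← hu_def, ← hv_def, ← hsβ, ← hcβ, ← hsδ, ← hcδ]
  rw [← hu_def] at hu
  rw [← hv_def] at hv
  field_simp
  ring

lemma cos_sin_arccos_of_sq_add_sq {p r : ℝ} (h : p ^ 2 + r ^ 2 = 1) (hr : 0 ≤ r) :
    cos (arccos p) = p ∧ sin (arccos p) = r := by
  refine ⟨cos_arccos (by nlinarith) (by nlinarith), ?_⟩
  rw [sin_arccos, ← h, add_sub_cancel_left, sqrt_sq hr]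

/-- The law of cosines and the law of sines for the angle between the side `a` and the diagonal. -/
lemma cos_sin_arccos_diag {a d x E : ℝ} (ha : 0 < a) (hd : 0 < d) (hx : x ^ 2 < 1) (hE : 0 < E)
    (hs : E ^ 2 = diagSq a d x) :
    cos (arccos ((a ^ 2 + E ^ 2 - d ^ 2) / (2 * a * E))) = (a + d * x) / E ∧
      sin (arccos ((a ^ 2 + E ^ 2 - d ^ 2) / (2 * a * E))) = d * √(1 - x ^ 2) / E := by
  have h : (a ^ 2 + E ^ 2 - d ^ 2) / (2 * a * E) = (a + d * x) / E := by
    rw [hs, diagSq]; field_simp; ring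
  rw [h]
  refine cos_sin_arccos_of_sq_add_sq ?_ (by positivity)
  rw [div_pow, div_pow, mul_pow, sq_sqrt (sub_pos.2 hx).le, hs, ← add_div,
    div_eq_one_iff_eq (by rw [← hs]; positivity), diagSq]
  ring

lemma cos_sin_arccos_add_arccos {a b c d x E : ℝ} (ha : 0 < a) (hb : 0 < b) (hc : 0 < c)
    (hd : 0 < d) (hx : x ^ 2 < 1) (hy : oppCos a b c d x ^ 2 < 1) (hE : E = √(diagSq a d x)) :
    cos (arccos ((a ^ 2 + E ^ 2 - d ^ 2) / (2 * a * E)) +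
        arccos ((b ^ 2 + E ^ 2 - c ^ 2) / (2 * b * E))) = cosAdj a b c d x (oppCos a b c d x) ∧
      sin (arccos ((a ^ 2 + E ^ 2 - d ^ 2) / (2 * a * E)) +
        arccos ((b ^ 2 + E ^ 2 - c ^ 2) / (2 * b * E))) =
          sinAdj a b c d x (oppCos a b c d x) := by
  have hs := diagSq_pos ha hd hx
  have hE₀ : 0 < E := hE ▸ sqrt_pos.2 hs
  have hE₂ : E ^ 2 = diagSq a d x := by rw [hE, sq_sqrt hs.le]
  obtain ⟨h₁, h₂⟩ := cos_sin_arccos_diag ha hd hx hE₀ hE₂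
  obtain ⟨h₃, h₄⟩ := cos_sin_arccos_diag (x := -oppCos a b c d x) hb hc (by rwa [neg_sq]) hE₀
    (by rw [hE₂, diagSq_eq_of_oppCos hb hc, diagSq]; ring)
  rw [neg_sq] at h₄
  rw [cos_add, sin_add, h₁, h₂, h₃, h₄, cosAdj, sinAdj, ← hE₂]
  constructor <;> field_simp <;> ring

/-- Fix positive reals `a, b, c, d`. For `x ∈ (−1, 1)` set `E(x) = √(a² + d² + 2adx)` and
`g(x) = cos(arccos((a² + E² − d²)/(2aE)) + arccos((b² + E² − c²)/(2bE)))`.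
Let `α ∈ (0, π)`, `x₀ = −cos α`, suppose all the arccos arguments appearing in the
definitions of `g`, `γ` and `δ` lie in `(−1, 1)` at `x₀`, and that the associated interior
angles `β, γ, δ` all lie in `(0, π)`. Then `g` is twice differentiable at `x₀` with
`g''(x₀) = k (−ad sin α cot γ − ab sin β cot δ − bc sin γ cot α − cd sin δ cot β)`,
where `k = d sin β sin δ/(b² c sin²α sin²γ)`. -/
theorem g_second_deriv (a b c d : ℝ) (ha : 0 < a) (hb : 0 < b) (hc : 0 < c) (hd : 0 < d)
    (E g : ℝ → ℝ)
    (hE : ∀ x, E x = Real.sqrt (a ^ 2 + d ^ 2 + 2 * a * d * x))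
    (hg : ∀ x, g x = Real.cos (Real.arccos ((a ^ 2 + (E x) ^ 2 - d ^ 2) / (2 * a * E x))
      + Real.arccos ((b ^ 2 + (E x) ^ 2 - c ^ 2) / (2 * b * E x))))
    (α x₀ : ℝ) (hα : α ∈ Ioo 0 π) (hx₀ : x₀ = -Real.cos α)
    (harg₁ : (a ^ 2 + (E x₀) ^ 2 - d ^ 2) / (2 * a * E x₀) ∈ Ioo (-1 : ℝ) 1)
    (harg₂ : (b ^ 2 + (E x₀) ^ 2 - c ^ 2) / (2 * b * E x₀) ∈ Ioo (-1 : ℝ) 1)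
    (harg₃ : (b ^ 2 + c ^ 2 - (E x₀) ^ 2) / (2 * b * c) ∈ Ioo (-1 : ℝ) 1)
    (harg₄ : (d ^ 2 + (E x₀) ^ 2 - a ^ 2) / (2 * d * E x₀) ∈ Ioo (-1 : ℝ) 1)
    (harg₅ : (c ^ 2 + (E x₀) ^ 2 - b ^ 2) / (2 * c * E x₀) ∈ Ioo (-1 : ℝ) 1)
    (β γ δ : ℝ)
    (hβ : β = Real.arccos ((a ^ 2 + (E x₀) ^ 2 - d ^ 2) / (2 * a * E x₀))
      + Real.arccos ((b ^ 2 + (E x₀) ^ 2 - c ^ 2) / (2 * b * E x₀)))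
    (hγ : γ = Real.arccos ((b ^ 2 + c ^ 2 - (E x₀) ^ 2) / (2 * b * c)))
    (hδ : δ = Real.arccos ((d ^ 2 + (E x₀) ^ 2 - a ^ 2) / (2 * d * E x₀))
      + Real.arccos ((c ^ 2 + (E x₀) ^ 2 - b ^ 2) / (2 * c * E x₀)))
    (hβ' : β ∈ Ioo 0 π) (hγ' : γ ∈ Ioo 0 π) (hδ' : δ ∈ Ioo 0 π) :
    DifferentiableAt ℝ g x₀ ∧
    HasDerivAt (deriv g)
      (d * Real.sin β * Real.sin δ / (b ^ 2 * c * (Real.sin α) ^ 2 * (Real.sin γ) ^ 2) *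
        (-(a * d * Real.sin α * (Real.cos γ / Real.sin γ))
          - a * b * Real.sin β * (Real.cos δ / Real.sin δ)
          - b * c * Real.sin γ * (Real.cos α / Real.sin α)
          - c * d * Real.sin δ * (Real.cos β / Real.sin β))) x₀ := by
  have hx : x₀ ^ 2 < 1 := by
    rw [hx₀, neg_sq]
    nlinarith [sin_sq_add_cos_sq α, sin_pos_of_mem_Ioo hα]
  have hE' : ∀ x, E x = √(diagSq a d x) := hE
  have hE₂ : E x₀ ^ 2 = diagSq a d x₀ := by rw [hE', sq_sqrt (diagSq_pos ha hd hx).le]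
  rw [hE₂, ← oppCos] at harg₃ hγ
  have hy : oppCos a b c d x₀ ^ 2 < 1 :=
    (sq_lt_one_iff_abs_lt_one _).2 (abs_lt.2 harg₃)
  have hnhds : ∀ᶠ x in nhds x₀, x ^ 2 < 1 ∧ oppCos a b c d x ^ 2 < 1 :=
    ((continuousAt_id.pow 2).eventually_lt_const hx).and
      (((hasDerivAt_oppCos a d x₀ hb hc).continuousAt.pow 2).eventually_lt_const hy)
  have hg' : ∀ᶠ x in nhds x₀, g x = cosAdj a b c d x (oppCos a b c d x) :=
    hnhds.mono fun x h => by
      rw [hg, (cos_sin_arccos_add_arccos ha hb hc hd h.1 h.2 (hE' x)).1]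
  refine ⟨((hasDerivAt_cosAdj ha hb hc hd hx hy).congr_of_eventuallyEq hg').differentiableAt, ?_⟩
  obtain ⟨hcβ, hsβ⟩ := cos_sin_arccos_add_arccos ha hb hc hd hx hy (hE' x₀)
  obtain ⟨hcδ, hsδ⟩ := cos_sin_arccos_add_arccos hd hc hb ha hx (by rwa [oppCos_comm] at hy)
    ((hE' x₀).trans (by rw [diagSq_comm]))
  rw [← hβ] at hcβ hsβ
  rw [← hδ, ← oppCos_comm a b c d] at hcδ hsδ
  have hcγ : cos γ = oppCos a b c d x₀ := by rw [hγ, cos_arccos harg₃.1.le harg₃.2.le]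
  have hcα : cos α = -x₀ := by rw [hx₀, neg_neg]
  have hsα : sin α = √(1 - x₀ ^ 2) := by
    rw [hx₀, neg_sq, ← sin_sq, sqrt_sq (sin_pos_of_mem_Ioo hα).le]
  have hsγ : sin γ = √(1 - cos γ ^ 2) := by
    rw [← sin_sq, sqrt_sq (sin_pos_of_mem_Ioo hγ').le]
  rw [← hcγ] at hcβ hsβ hcδ hsδ
  rw [hcα]
  refine (hasDerivAt_deriv_cosAdj ha hb hc hd hx hy hcγ hsα hsγ hsβ hcβ hsδ hcδ
    (sin_pos_of_mem_Ioo hβ').ne' (sin_pos_of_mem_Ioo hδ').ne').congr_of_eventuallyEq ?_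
  filter_upwards [hnhds, hg'.eventually_nhds] with x h hgx
  exact ((hasDerivAt_cosAdj ha hb hc hd h.1 h.2).congr_of_eventuallyEq hgx).deriv
end

section
/- If cross(X₁ − F₂, X₂ − F₂) > 0 and cross(X₂ − F₁, X₁ − F₁) > 0, where cross((u₁,u₂),(v₁,v₂)) = u₁v₂ − u₂v₁, then t₃·f² + t₄·l² > 0, i.e., (1 + cos(θ₁ + θ₂))·f² > (1 + cos(θ₁ − θ₂))·l². -/
open Real Set

/-- Let `0 < f < l`, `θ₁ ∈ (0, π)`, `θ₂ ∈ (−π, 0)`, and set `F₁ = (−f, 0)`, `F₂ = (f, 0)`,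
`X₁ = (l cos θ₁, √(l² − f²) sin θ₁)`, `X₂ = (l cos θ₂, √(l² − f²) sin θ₂)` in `ℝ²`.
If `cross(X₁ − F₂, X₂ − F₂) > 0` and `cross(X₂ − F₁, X₁ − F₁) > 0`, then
`(1 + cos(θ₁ + θ₂)) f² > (1 + cos(θ₁ − θ₂)) l²`, i.e. `t₃ f² + t₄ l² > 0`. -/
theorem ellipse_convexity_ineq (f l θ₁ θ₂ : ℝ) (hf : 0 < f) (hfl : f < l)
    (hθ₁ : θ₁ ∈ Ioo 0 π) (hθ₂ : θ₂ ∈ Ioo (-π) 0)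
    (F₁ F₂ X₁ X₂ : ℝ × ℝ)
    (hF₁ : F₁ = (-f, 0)) (hF₂ : F₂ = (f, 0))
    (hX₁ : X₁ = (l * Real.cos θ₁, Real.sqrt (l ^ 2 - f ^ 2) * Real.sin θ₁))
    (hX₂ : X₂ = (l * Real.cos θ₂, Real.sqrt (l ^ 2 - f ^ 2) * Real.sin θ₂))
    (hcross₁ : 0 < (X₁ - F₂).1 * (X₂ - F₂).2 - (X₁ - F₂).2 * (X₂ - F₂).1)
    (hcross₂ : 0 < (X₂ - F₁).1 * (X₁ - F₁).2 - (X₂ - F₁).2 * (X₁ - F₁).1) :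
    (1 + Real.cos (θ₁ + θ₂)) * f ^ 2 > (1 + Real.cos (θ₁ - θ₂)) * l ^ 2 := by
  subst hF₁ hF₂ hX₁ hX₂
  obtain ⟨a, d, rfl, rfl⟩ : ∃ a d : ℝ, θ₁ = a + d ∧ θ₂ = a - d :=
    ⟨(θ₁ + θ₂) / 2, (θ₁ - θ₂) / 2, by ring, by ring⟩
  have hd : 0 < Real.sin d :=
    Real.sin_pos_of_pos_of_lt_pi (by linarith [hθ₁.1, hθ₂.2]) (by linarith [hθ₁.2, hθ₂.1])
  have hw : 0 < Real.sqrt (l ^ 2 - f ^ 2) := Real.sqrt_pos.mpr (by nlinarith)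
  have hpos : 0 < 2 * Real.sqrt (l ^ 2 - f ^ 2) * Real.sin d := by positivity
  simp only [Prod.fst_sub, Prod.snd_sub, Real.sin_add, Real.sin_sub, Real.cos_add,
    Real.cos_sub] at hcross₁ hcross₂
  have hsq := Real.sin_sq_add_cos_sq a
  have h₁ : 0 < f * Real.cos a - l * Real.cos d := by
    refine pos_of_mul_pos_right (lt_of_lt_of_eq hcross₁ ?_) hpos.le
    linear_combination (-2 * l * √(l ^ 2 - f ^ 2) * Real.sin d * Real.cos d) * hsq
  have h₂ : 0 < f * Real.cos a + l * Real.cos d := by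
    refine pos_of_mul_pos_right (lt_of_lt_of_eq hcross₂ ?_) hpos.le
    linear_combination (2 * l * √(l ^ 2 - f ^ 2) * Real.sin d * Real.cos d) * hsq
  rw [show a + d + (a - d) = 2 * a by ring, show a + d - (a - d) = 2 * d by ring,
    Real.cos_two_mul, Real.cos_two_mul]
  linarith [mul_pos h₁ h₂]
end

section
/- One has t₁·f² + t₂·l² > 0, i.e., (2 sin²θ₁ − sin²(θ₁ − θ₂) + 2 sin²θ₂)·l² > sin²(θ₁ + θ₂)·f². -/
open Real Set

/-- Let `0 < f < l`, `θ₁ ∈ (0, π)`, `θ₂ ∈ (−π, 0)`, and put `t₁ = −sin²(θ₁ + θ₂)`,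
`t₂ = 2 sin²θ₁ − sin²(θ₁ − θ₂) + 2 sin²θ₂`. Then `t₁ f² + t₂ l² > 0`, i.e.
`(2 sin²θ₁ − sin²(θ₁ − θ₂) + 2 sin²θ₂) l² > sin²(θ₁ + θ₂) f²`. -/
theorem ellipse_t1_t2_pos (f l θ₁ θ₂ : ℝ) (hf : 0 < f) (hfl : f < l)
    (hθ₁ : θ₁ ∈ Ioo 0 π) (hθ₂ : θ₂ ∈ Ioo (-π) 0) :
    0 < -(Real.sin (θ₁ + θ₂)) ^ 2 * f ^ 2
      + (2 * (Real.sin θ₁) ^ 2 - (Real.sin (θ₁ - θ₂)) ^ 2 + 2 * (Real.sin θ₂) ^ 2) * l ^ 2 := by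
  have h₁ : 0 < sin θ₁ := sin_pos_of_mem_Ioo hθ₁
  have h₂ : sin θ₂ < 0 := sin_neg_of_neg_of_neg_pi_lt hθ₂.2 hθ₂.1
  have key : 2 * sin θ₁ ^ 2 - sin (θ₁ - θ₂) ^ 2 + 2 * sin θ₂ ^ 2
      = sin (θ₁ + θ₂) ^ 2 + 4 * (sin θ₁ * sin θ₂) ^ 2 := by
    rw [sin_add, sin_sub]
    ring_nf
    rw [cos_sq' θ₁, cos_sq' θ₂]
    ring
  have hsq : 0 ≤ sin (θ₁ + θ₂) ^ 2 * (l ^ 2 - f ^ 2) :=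
    mul_nonneg (sq_nonneg _) (sub_nonneg.2 (pow_le_pow_left₀ hf.le hfl.le 2))
  have hpos : 0 < 4 * (sin θ₁ * sin θ₂) ^ 2 * l ^ 2 := by
    have hl : 0 < l := hf.trans hfl
    have hne : sin θ₁ * sin θ₂ ≠ 0 := mul_ne_zero h₁.ne' h₂.ne
    positivity
  rw [key]
  linarith
end

section
/- If S(0) = 0 and S(ω̃) = 0 for some ω̃ ∈ (0, π], then S(ω) = 0 for every ω ∈ ℝ. -/
open Real

/-- Rotation of the plane `ℝ²` by angle `θ`. -/
noncomputable def rot2 (θ : ℝ) (v : ℝ × ℝ) : ℝ × ℝ :=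
  (Real.cos θ * v.1 - Real.sin θ * v.2, Real.sin θ * v.1 + Real.cos θ * v.2)

theorem rot2_sum (θ : ℝ) {ι : Type*} (s : Finset ι) (f : ι → ℝ × ℝ) :
    rot2 θ (∑ i ∈ s, f i) = ∑ i ∈ s, rot2 θ (f i) := by
  ext <;> simp [rot2, Prod.fst_sum, Prod.snd_sum, Finset.mul_sum, Finset.sum_sub_distrib,
    Finset.sum_add_distrib]

theorem rot2_zero (v : ℝ × ℝ) : rot2 0 v = v := by
  ext <;> simp [rot2]

/-- A rotation whose angle has cosine different from `1` fixes only the origin. -/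
theorem eq_zero_of_rot2_eq_self {θ : ℝ} {v : ℝ × ℝ} (hθ : Real.cos θ ≠ 1)
    (h : rot2 θ v = v) : v = 0 := by
  have h₁ : Real.cos θ * v.1 - Real.sin θ * v.2 = v.1 := congrArg Prod.fst h
  have h₂ : Real.sin θ * v.1 + Real.cos θ * v.2 = v.2 := congrArg Prod.snd h
  have hne : 2 * (1 - Real.cos θ) ≠ 0 := mul_ne_zero two_ne_zero (sub_ne_zero.mpr hθ.symm)
  have hsq := Real.sin_sq_add_cos_sq θ
  ext
  · refine (mul_eq_zero.mp ?_).resolve_left hne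
    linear_combination (Real.cos θ - 1) * h₁ + Real.sin θ * h₂ - v.1 * hsq
  · refine (mul_eq_zero.mp ?_).resolve_left hne
    linear_combination (Real.cos θ - 1) * h₂ - Real.sin θ * h₁ - v.2 * hsq

/-- Let `m ≥ 2` be even, `a₁, …, a_m, b₁, …, b_m, a'₁, …, a'₄` positive reals and
`β₁, …, β_m, β'₁, …, β'₄` reals, and define the loop sum
`S(ω) = Σ_{i odd} R^{βᵢ}(aᵢ − bᵢ cos ω, −bᵢ sin ω) + Σ_{i even} R^{βᵢ}(aᵢ + bᵢ cos ω, bᵢ sin ω)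
 + Σ_{k=1}^{4} R^{β'ₖ}(a'ₖ, 0)`.
If `S(0) = 0` and `S(ω₀) = 0` for some `ω₀ ∈ (0, π]`, then `S(ω) = 0` for every `ω ∈ ℝ`. -/
theorem ring_closure_all_omega (m : ℕ) (hm : 2 ≤ m) (hmeven : Even m)
    (a b a' : ℕ → ℝ) (β β' : ℕ → ℝ)
    (hapos : ∀ i ∈ Finset.Icc 1 m, 0 < a i) (hbpos : ∀ i ∈ Finset.Icc 1 m, 0 < b i)
    (ha'pos : ∀ k ∈ Finset.Icc 1 4, 0 < a' k)
    (S : ℝ → ℝ × ℝ)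
    (hS : ∀ ω, S ω =
      (∑ i ∈ Finset.Icc 1 m,
        if Odd i then rot2 (β i) (a i - b i * Real.cos ω, -(b i * Real.sin ω))
        else rot2 (β i) (a i + b i * Real.cos ω, b i * Real.sin ω))
      + ∑ k ∈ Finset.Icc 1 4, rot2 (β' k) (a' k, 0))
    (h0 : S 0 = 0) (ω₀ : ℝ) (hω₀ : ω₀ ∈ Set.Ioc 0 π) (hω₀0 : S ω₀ = 0) :
    ∀ ω, S ω = 0 := by
  obtain ⟨A, U, hAU⟩ : ∃ A U : ℝ × ℝ, ∀ ω, S ω = A + rot2 ω U := by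
    refine ⟨∑ i ∈ Finset.Icc 1 m, rot2 (β i) (a i, 0) +
      ∑ k ∈ Finset.Icc 1 4, rot2 (β' k) (a' k, 0),
      ∑ i ∈ Finset.Icc 1 m, rot2 (β i) (if Odd i then -b i else b i, 0), fun ω => ?_⟩
    rw [hS, rot2_sum, add_right_comm, ← Finset.sum_add_distrib]
    congr 1
    refine Finset.sum_congr rfl fun i _ => ?_
    split_ifs <;> ext <;> simp only [rot2, Prod.fst_add, Prod.snd_add] <;> ring
  have hcos : Real.cos ω₀ ≠ 1 := by
    have h := Real.cos_lt_cos_of_nonneg_of_le_pi le_rfl hω₀.2 hω₀.1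
    rw [Real.cos_zero] at h
    exact h.ne
  rw [hAU, rot2_zero] at h0
  rw [hAU] at hω₀0
  have hU : U = 0 := eq_zero_of_rot2_eq_self hcos (add_left_cancel (hω₀0.trans h0.symm))
  subst hU
  intro ω
  obtain rfl : A = 0 := by simpa using h0
  simp [hAU, rot2]
end
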